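/- Let f be a piecewise contracting interval map, injective on each contraction piece, with D ⊂ X̃. If x ∈ X̃ and Δ_lr(x) ≠ ∅, then there exists i ∈ {1,...,N-1} such that c_i ∈ Δ_lr(x), the class [c_i] is minimal for the partial order ≼⁺ on Δ_lr/∼⁺, and ω(x) = ω(d_i^+) = closure(O(d_i^+)). -/

import Mathlib

open Filter Topology Set

/-- A piecewise contracting interval map on `X = [c 0, c N]` with contraction pieces
`X_i` delimited by the points `c 0 < c 1 < … < c N`, contraction rate `lam ∈ (0,1)`,
and `fe i` the (unique) continuous `lam`-Lipschitz extension of `f` restricted to the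
`i`-th piece to its closure `[c (i-1), c i]`. The pieces are
`X_1 = [c 0, c 1)`, `X_i = (c (i-1), c i)` for `1 < i < N`, `X_N = (c (N-1), c N]`. -/
structure PCIM where
  N : ℕ
  hN : 2 ≤ N
  c : ℕ → ℝ
  lam : ℝ
  f : ℝ → ℝ
  fe : ℕ → ℝ → ℝ
  hc : StrictMonoOn c (Set.Iic N)
  hlam : lam ∈ Set.Ioo (0 : ℝ) 1
  hmap : Set.MapsTo f (Set.Icc (c 0) (c N)) (Set.Icc (c 0) (c N))
  hfe_lip : ∀ i, 1 ≤ i → i ≤ N →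
    ∀ x ∈ Set.Icc (c (i - 1)) (c i), ∀ y ∈ Set.Icc (c (i - 1)) (c i),
      |fe i x - fe i y| ≤ lam * |x - y|
  hfe_eq : ∀ i, 1 ≤ i → i ≤ N → ∀ x ∈ Set.Ioo (c (i - 1)) (c i), fe i x = f x
  hfe_left : fe 1 (c 0) = f (c 0)
  hfe_right : fe N (c N) = f (c N)

namespace PCIM

variable (P : PCIM)

/-- The phase space `X = [c 0, c N]`. -/
def X : Set ℝ := Set.Icc (P.c 0) (P.c P.N)

/-- The `i`-th contraction piece (`1 ≤ i ≤ N`). -/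
def piece (i : ℕ) : Set ℝ :=
  Set.Ioo (P.c (i - 1)) (P.c i)
    ∪ (if i = 1 then {P.c 0} else (∅ : Set ℝ))
    ∪ (if i = P.N then {P.c P.N} else (∅ : Set ℝ))

/-- `Δ`, the set of interior boundary points of the pieces. -/
def Δ : Set ℝ := {y | ∃ i, 1 ≤ i ∧ i < P.N ∧ y = P.c i}

/-- `X̃ = ⋂ n, f⁻ⁿ(X \ Δ)`: points whose whole forward orbit stays in `X` and avoids `Δ`. -/
def Xt : Set ℝ := {x | ∀ n : ℕ, P.f^[n] x ∈ P.X \ P.Δ}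

/-- Forward orbit of `x`. -/
def orbit (x : ℝ) : Set ℝ := Set.range fun n : ℕ => P.f^[n] x

/-- The ω-limit set of `x`: limits of subsequences of the forward orbit. -/
def omega (x : ℝ) : Set ℝ :=
  {y | ∃ φ : ℕ → ℕ, StrictMono φ ∧
    Filter.Tendsto (fun n => P.f^[φ n] x) Filter.atTop (nhds y)}

/-- `d_i^- = f_i (c_i)`, the left lateral limit of `f` at `c i`. -/
def dminus (i : ℕ) : ℝ := P.fe i (P.c i)

/-- `d_i^+ = f_{i+1} (c_i)`, the right lateral limit of `f` at `c i`. -/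
def dplus (i : ℕ) : ℝ := P.fe (i + 1) (P.c i)

/-- `D⁻ = {d_1^-, …, d_{N-1}^-}`. -/
def Dminus : Set ℝ := {y | ∃ i, 1 ≤ i ∧ i < P.N ∧ y = P.dminus i}

/-- `D⁺ = {d_1^+, …, d_{N-1}^+}`. -/
def Dplus : Set ℝ := {y | ∃ i, 1 ≤ i ∧ i < P.N ∧ y = P.dplus i}

/-- `D`, the set of all one-sided limits of `f` at endpoints of the pieces. -/
def D : Set ℝ := P.Dminus ∪ P.Dplus ∪ {P.fe 1 (P.c 0), P.fe P.N (P.c P.N)}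

/-- `A` is pseudo-invariant: for every `x ∈ A` at least one one-sided limit of `f`
at `x` (i.e. some `fe i x` with `x` in the closure of the `i`-th piece) belongs to `A`. -/
def PseudoInvariant (A : Set ℝ) : Prop :=
  ∀ x ∈ A, ∃ i, 1 ≤ i ∧ i ≤ P.N ∧ x ∈ Set.Icc (P.c (i - 1)) (P.c i) ∧ P.fe i x ∈ A

/-- `F_i(A) = closure (f (A ∩ X_i))`. -/
def Fmap (i : ℕ) (A : Set ℝ) : Set ℝ := closure (P.f '' (A ∩ P.piece i))

/-- For a word `w = [i_1, …, i_n]`, the set `F_{i_n} ∘ … ∘ F_{i_1} (X)`. -/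
def atomOf (w : List ℕ) : Set ℝ := w.foldl (fun S i => P.Fmap i S) P.X

/-- `A` is an atom of generation `n`. -/
def IsAtomGen (n : ℕ) (A : Set ℝ) : Prop :=
  ∃ w : List ℕ, w.length = n ∧ (∀ i ∈ w, 1 ≤ i ∧ i ≤ P.N) ∧
    A = P.atomOf w ∧ A.Nonempty

/-- `Lam n` is `Λ_{n+1}` of the paper: `Λ_1 = closure (f(X \ Δ))`,
`Λ_{n+1} = closure (f(Λ_n \ Δ))`. -/
def Lam (P : PCIM) : ℕ → Set ℝ
  | 0 => closure (P.f '' (P.X \ P.Δ))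
  | n + 1 => closure (P.f '' (P.Lam n \ P.Δ))

/-- The attractor `Λ = ⋂_{n ≥ 1} Λ_n`. -/
def attractor : Set ℝ := ⋂ n : ℕ, P.Lam n

/-- `c i ∈ Δ_lr(x)`: the boundary point `c i` is left-right recurrently visited by the
orbit of `x`. -/
def lrVisited (x : ℝ) (i : ℕ) : Prop :=
  1 ≤ i ∧ i < P.N ∧
  ∃ l r : ℕ → ℕ, StrictMono l ∧ StrictMono r ∧
    (∀ j, P.f^[l j] x ∈ P.piece i) ∧ (∀ j, P.f^[r j] x ∈ P.piece (i + 1)) ∧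
    Filter.Tendsto (fun j => P.f^[l j] x) Filter.atTop (nhds (P.c i)) ∧
    Filter.Tendsto (fun j => P.f^[r j] x) Filter.atTop (nhds (P.c i))

/-- `c i ∈ Δ_lr`: `c i` is left-right recurrently visited by the orbit of some point
of `X̃`. -/
def inΔlr (i : ℕ) : Prop := ∃ x ∈ P.Xt, P.lrVisited x i

/-- The set `Δ_lr ⊆ Δ`. -/
def ΔlrSet : Set ℝ := {y | ∃ i, P.inΔlr i ∧ y = P.c i}

/-- The relation `∼⁺` on `Δ_lr`: `c_i ∼⁺ c_j` iff `c_i = c_j` or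
(`c_i ∈ Δ_lr(d_j^+)` and `c_j ∈ Δ_lr(d_i^+)`). -/
def simP (a b : ℝ) : Prop :=
  a = b ∨ ∃ i j, P.inΔlr i ∧ P.inΔlr j ∧ a = P.c i ∧ b = P.c j ∧
    P.lrVisited (P.dplus j) i ∧ P.lrVisited (P.dplus i) j

/-- The relation `≼⁺` (on representatives): `[c_i] ≼⁺ [c_j]` iff `[c_i] = [c_j]` or
`c_i ∈ Δ_lr(d_j^+)`. -/
def preP (a b : ℝ) : Prop :=
  P.simP a b ∨ ∃ i j, P.inΔlr i ∧ P.inΔlr j ∧ a = P.c i ∧ b = P.c j ∧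
    P.lrVisited (P.dplus j) i

/-- `[c i]` is a minimal class for the partial order `≼⁺`. -/
def MinimalClass (i : ℕ) : Prop :=
  P.inΔlr i ∧ ∀ j, P.inΔlr j → P.preP (P.c j) (P.c i) → P.simP (P.c j) (P.c i)

/-- `f` is injective on each contraction piece. -/
def InjPieces : Prop := ∀ i, 1 ≤ i → i ≤ P.N → Set.InjOn P.f (P.piece i)

/-- `f` is (strictly) increasing on each contraction piece. -/
def IncrPieces : Prop := ∀ i, 1 ≤ i → i ≤ P.N → StrictMonoOn P.f (P.piece i)

/-- `x` is a periodic point of `f`. -/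
def IsPeriodic (x : ℝ) : Prop := ∃ p : ℕ, 1 ≤ p ∧ P.f^[p] x = x

/-- `η` is the itinerary of `x`: `f^[n] x ∈ X_{η n}` for all `n`. -/
def IsItinerary (x : ℝ) (η : ℕ → ℕ) : Prop :=
  ∀ n, 1 ≤ η n ∧ η n ≤ P.N ∧ P.f^[n] x ∈ P.piece (η n)

end PCIM

/-- The word of length `n` of the sequence `η` starting at position `t`. -/
def wordAt (η : ℕ → ℕ) (t n : ℕ) : List ℕ := (List.range n).map fun m => η (t + m)

/-- The complexity function of the sequence `η`: the number of distinct words of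
length `n` occurring in `η`. -/
noncomputable def complexity (η : ℕ → ℕ) (n : ℕ) : ℕ := Set.ncard {w : List ℕ | ∃ t, w = wordAt η t n}

namespace PCIM

variable {P : PCIM}

/-- The orbit of `y` is infinitely often in every set of the filter `F`. -/
def Visits (P : PCIM) (y : ℝ) (F : Filter ℝ) : Prop :=
  ∀ s ∈ F, ∃ᶠ n in atTop, P.f^[n] y ∈ s

theorem Visits.mono {y : ℝ} {F G : Filter ℝ} (h : P.Visits y F) (hFG : F ≤ G) : P.Visits y G :=
  fun s hs => h s (hFG hs)

theorem Visits.exists_strictMono {y : ℝ} {F : Filter ℝ} [F.IsCountablyGenerated]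
    (h : P.Visits y F) :
    ∃ θ : ℕ → ℕ, StrictMono θ ∧ Tendsto (fun n => P.f^[θ n] y) atTop F :=
  subseq_tendsto_of_neBot (u := fun n => P.f^[n] y)
    (inf_neBot_iff_frequently_left.2 fun hp => h _ hp)

theorem visits_of_strictMono {y : ℝ} {F : Filter ℝ} {θ : ℕ → ℕ} (hθ : StrictMono θ)
    (h : Tendsto (fun n => P.f^[θ n] y) atTop F) : P.Visits y F := fun _ hs =>
  hθ.tendsto_atTop.frequently (h.eventually_mem hs).frequently

theorem mem_omega_iff {y z : ℝ} : z ∈ P.omega y ↔ P.Visits y (𝓝 z) :=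
  ⟨fun ⟨_, hφ, h⟩ => visits_of_strictMono hφ h, fun h => h.exists_strictMono⟩

theorem Visits.map {y : ℝ} {F G : Filter ℝ} (h : P.Visits y F) (hf : Tendsto P.f F G) :
    P.Visits y G := fun s hs => by
  refine (tendsto_add_atTop_nat 1).frequently ((h _ (hf hs)).mono fun n hn => ?_)
  rwa [Function.iterate_succ_apply']

theorem Xt_iterate {y : ℝ} (hy : y ∈ P.Xt) (n : ℕ) : P.f^[n] y ∈ P.Xt := fun m => by
  rw [← Function.iterate_add_apply]
  exact hy _

theorem Visits.within {y : ℝ} {z : ℝ} (hy : y ∈ P.Xt) (h : P.Visits y (𝓝 z)) :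
    P.Visits y (𝓝[P.X] z) := fun s hs => by
  obtain ⟨u, hu, hus⟩ := mem_nhdsWithin_iff_exists_mem_nhds_inter.1 hs
  exact (h u hu).mono fun n hn => hus ⟨hn, (hy n).1⟩

theorem Visits.iterate_right {x y : ℝ} {F : Filter ℝ} (h : P.Visits x F) (m : ℕ)
    (hy : P.f^[m] x = y) : P.Visits y F := fun s hs => by
  subst hy
  rw [frequently_atTop]
  intro a
  obtain ⟨b, hb, hbs⟩ := frequently_atTop.1 (h s hs) (a + m)
  refine ⟨b - m, by omega, ?_⟩
  rwa [← Function.iterate_add_apply, Nat.sub_add_cancel (by omega)]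

/-- Accumulation from within an open set is transitive. -/
theorem Visits.trans {x y w : ℝ} {A : Set ℝ} (hA : IsOpen A)
    (hxy : ∀ n, P.Visits x (𝓝 (P.f^[n] y))) (hy : P.Visits y (𝓝[A] w)) :
    P.Visits x (𝓝[A] w) := fun s hs => by
  obtain ⟨u, hu, hwu, hus⟩ := mem_nhdsWithin.1 hs
  obtain ⟨n, hn⟩ := (hy (u ∩ A)
    (inter_mem (mem_nhdsWithin_of_mem_nhds (hu.mem_nhds hwu)) self_mem_nhdsWithin)).exists
  exact (hxy n _ ((hu.inter hA).mem_nhds hn)).mono fun m hm => hus hm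

/-! ### Pieces and lateral limits -/

theorem c_lt {i j : ℕ} (hij : i < j) (hj : j ≤ P.N) : P.c i < P.c j :=
  P.hc (mem_Iic.2 (hij.le.trans hj)) (mem_Iic.2 hj) hij

theorem c_le {i j : ℕ} (hij : i ≤ j) (hj : j ≤ P.N) : P.c i ≤ P.c j :=
  P.hc.monotoneOn (mem_Iic.2 (hij.trans hj)) (mem_Iic.2 hj) hij

theorem exists_mem_Icc {y : ℝ} (hy : y ∈ P.X) :
    ∃ i, 1 ≤ i ∧ i ≤ P.N ∧ y ∈ Icc (P.c (i - 1)) (P.c i) := by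
  classical
  have hex : ∃ i, 1 ≤ i ∧ y ≤ P.c i := ⟨P.N, by have := P.hN; omega, hy.2⟩
  have hs := Nat.find_spec hex
  refine ⟨Nat.find hex, hs.1, Nat.find_min' hex ⟨by have := P.hN; omega, hy.2⟩, ?_, hs.2⟩
  by_cases h1 : Nat.find hex = 1
  · rw [h1]
    exact hy.1
  · have := Nat.find_min hex (m := Nat.find hex - 1) (by omega)
    by_contra hlt
    exact this ⟨by omega, (not_le.1 hlt).le⟩

theorem fe_eq_f {i : ℕ} (h1 : 1 ≤ i) (hN : i ≤ P.N) {y : ℝ}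
    (hy : y ∈ Icc (P.c (i - 1)) (P.c i)) (hΔ : y ∉ P.Δ) : P.fe i y = P.f y := by
  rcases hy.1.eq_or_lt with h | h
  · by_cases hi : i = 1
    · subst hi
      rw [← h]
      exact P.hfe_left
    · exact absurd ⟨i - 1, by omega, by omega, h.symm⟩ hΔ
  rcases hy.2.eq_or_lt with h' | h'
  · by_cases hi : i = P.N
    · subst hi
      rw [h']
      exact P.hfe_right
    · exact absurd ⟨i, h1, by omega, h'⟩ hΔ
  exact P.hfe_eq i h1 hN y ⟨h, h'⟩

theorem continuousOn_fe {i : ℕ} (h1 : 1 ≤ i) (hN : i ≤ P.N) :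
    ContinuousOn (P.fe i) (Icc (P.c (i - 1)) (P.c i)) := by
  have : LipschitzOnWith ⟨P.lam, P.hlam.1.le⟩ (P.fe i) (Icc (P.c (i - 1)) (P.c i)) :=
    LipschitzOnWith.of_dist_le_mul fun x hx y hy => P.hfe_lip i h1 hN x hx y hy
  exact this.continuousOn

theorem tendsto_f_right {i : ℕ} (hN : i < P.N) :
    Tendsto P.f (𝓝[>] P.c i) (𝓝 (P.dplus i)) := by
  have hlt : P.c i < P.c (i + 1) := c_lt (by omega) (by omega)
  have hc := (continuousOn_fe (P := P) (i := i + 1) (by omega) (by omega)) (P.c i)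
    (by simp [hlt.le])
  have hmem : Ioo (P.c i) (P.c (i + 1)) ∈ 𝓝[>] P.c i := Ioo_mem_nhdsGT hlt
  have h2 : Tendsto (P.fe (i + 1)) (𝓝[>] P.c i) (𝓝 (P.dplus i)) := by
    refine hc.mono_left (le_inf inf_le_left (le_principal_iff.2 ?_))
    exact mem_of_superset hmem (by simpa using Ioo_subset_Icc_self)
  refine h2.congr' ?_
  filter_upwards [hmem] with z hz
  exact P.hfe_eq (i + 1) (by omega) (by omega) z (by simpa using hz)

theorem tendsto_f_left {i : ℕ} (h1 : 1 ≤ i) (hN : i < P.N) :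
    Tendsto P.f (𝓝[<] P.c i) (𝓝 (P.dminus i)) := by
  have hlt : P.c (i - 1) < P.c i := c_lt (by omega) (by omega)
  have hc := (continuousOn_fe (P := P) (i := i) (by omega) (by omega)) (P.c i)
    (by simp [hlt.le])
  have hmem : Ioo (P.c (i - 1)) (P.c i) ∈ 𝓝[<] P.c i := Ioo_mem_nhdsLT hlt
  have h2 : Tendsto (P.fe i) (𝓝[<] P.c i) (𝓝 (P.dminus i)) := by
    refine hc.mono_left (le_inf inf_le_left (le_principal_iff.2 ?_))
    exact mem_of_superset hmem Ioo_subset_Icc_self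
  refine h2.congr' ?_
  filter_upwards [hmem] with z hz
  exact P.hfe_eq i (by omega) (by omega) z hz

/-- Two points of `X \ Δ` not separated by `Δ` lie in the same piece. -/
theorem exists_common_piece {a b : ℝ} (ha : a ∈ P.X \ P.Δ) (hb : b ∈ P.X \ P.Δ)
    (hab : ∀ z ∈ P.Δ, z ∉ uIcc a b) :
    ∃ i, 1 ≤ i ∧ i ≤ P.N ∧ a ∈ Icc (P.c (i - 1)) (P.c i) ∧ b ∈ Icc (P.c (i - 1)) (P.c i) := by
  wlog hle : a ≤ b generalizing a b
  · obtain ⟨i, h1, hN, h, h'⟩ := this hb ha (by rwa [uIcc_comm]) (not_le.1 hle).le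
    exact ⟨i, h1, hN, h', h⟩
  obtain ⟨i, h1, hN, hi⟩ := exists_mem_Icc ha.1
  refine ⟨i, h1, hN, hi, hi.1.trans hle, ?_⟩
  by_contra hlt
  rw [not_le] at hlt
  have hiN : i < P.N := by
    refine lt_of_le_of_ne hN fun h => ?_
    subst h
    exact hlt.not_ge hb.1.2
  refine hab (P.c i) ⟨i, h1, hiN, rfl⟩ ?_
  rw [uIcc_of_le hle]
  exact ⟨hi.2, hlt.le⟩

theorem abs_f_sub_le {a b : ℝ} (ha : a ∈ P.X \ P.Δ) (hb : b ∈ P.X \ P.Δ)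
    (hab : ∀ z ∈ P.Δ, z ∉ uIcc a b) : |P.f a - P.f b| ≤ P.lam * |a - b| := by
  obtain ⟨i, h1, hN, hia, hib⟩ := exists_common_piece ha hb hab
  rw [← fe_eq_f h1 hN hia ha.2, ← fe_eq_f h1 hN hib hb.2]
  exact P.hfe_lip i h1 hN a hia b hib

theorem finite_Δ : P.Δ.Finite := by
  refine ((Set.finite_Iio P.N).image P.c).subset ?_
  rintro _ ⟨i, -, hi, rfl⟩
  exact ⟨i, hi, rfl⟩

theorem tendsto_f_within {z : ℝ} (hz : z ∈ P.X \ P.Δ) :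
    Tendsto P.f (𝓝[P.X] z) (𝓝 (P.f z)) := by
  obtain ⟨ε, hε, hεΔ⟩ := Metric.isOpen_iff.1 finite_Δ.isClosed.isOpen_compl z hz.2
  rw [Metric.tendsto_nhdsWithin_nhds]
  intro η hη
  refine ⟨min ε η, lt_min hε hη, fun w hw hwz => ?_⟩
  have hwε : |w - z| < ε := hwz.trans_le (min_le_left _ _)
  have hball : uIcc w z ⊆ Metric.ball z ε := by
    rw [Real.ball_eq_Ioo]
    rw [abs_lt] at hwε
    intro t ht
    rw [mem_uIcc] at ht
    constructor <;> rcases ht with ht | ht <;> linarith [ht.1, ht.2]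
  have hle := abs_f_sub_le ⟨hw, hεΔ (hball left_mem_uIcc)⟩ hz
    fun t ht ht' => hεΔ (hball ht') ht
  rw [Real.dist_eq]
  have := P.hlam.2
  have hwη : |w - z| < η := hwz.trans_le (min_le_right _ _)
  nlinarith [abs_nonneg (w - z)]

theorem Visits.iterate {x y : ℝ} (hx : x ∈ P.Xt) (hy : y ∈ P.Xt) (h : P.Visits x (𝓝 y)) (n : ℕ) :
    P.Visits x (𝓝 (P.f^[n] y)) := by
  induction n with
  | zero => exact h
  | succ n ih =>
    rw [Function.iterate_succ_apply']
    exact (ih.within hx).map (tendsto_f_within (hy n))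

theorem dplus_mem (hD : P.D ⊆ P.Xt) {i : ℕ} (h1 : 1 ≤ i) (hN : i < P.N) : P.dplus i ∈ P.Xt :=
  hD (Or.inl (Or.inr ⟨i, h1, hN, rfl⟩))

theorem dminus_mem (hD : P.D ⊆ P.Xt) {i : ℕ} (h1 : 1 ≤ i) (hN : i < P.N) : P.dminus i ∈ P.Xt :=
  hD (Or.inl (Or.inl ⟨i, h1, hN, rfl⟩))

theorem piece_subset_Iio {i : ℕ} (hN : i < P.N) : P.piece i ⊆ Iio (P.c i) := by
  rintro z ((hz | hz) | hz)
  · exact hz.2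
  · split_ifs at hz with hi
    · rw [mem_singleton_iff.1 hz]
      exact c_lt (by omega) (by omega)
    · exact hz.elim
  · rw [if_neg (by omega)] at hz
    exact hz.elim

theorem piece_succ_subset_Ioi {i : ℕ} (h1 : 1 ≤ i) (hN : i < P.N) :
    P.piece (i + 1) ⊆ Ioi (P.c i) := by
  rintro z ((hz | hz) | hz)
  · exact hz.1
  · rw [if_neg (by omega)] at hz
    exact hz.elim
  · split_ifs at hz with hi
    · rw [mem_singleton_iff.1 hz]
      exact c_lt (by omega) (by omega)
    · exact hz.elim

theorem Ioo_subset_piece (i : ℕ) : Ioo (P.c (i - 1)) (P.c i) ⊆ P.piece i :=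
  fun _ hz => Or.inl (Or.inl hz)

theorem exists_seq_piece {y c : ℝ} {s A : Set ℝ} (hs : s ∈ 𝓝[A] c) (h : P.Visits y (𝓝[A] c)) :
    ∃ l : ℕ → ℕ, StrictMono l ∧ (∀ j, P.f^[l j] y ∈ s) ∧
      Tendsto (fun j => P.f^[l j] y) atTop (𝓝 c) := by
  obtain ⟨θ, hθ, hlim⟩ := h.exists_strictMono
  obtain ⟨M, hM⟩ := eventually_atTop.1 (hlim.eventually_mem hs)
  exact ⟨fun j => θ (j + M), fun a b hab => hθ (by omega), fun j => hM _ (by omega),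
    (tendsto_nhds_of_tendsto_nhdsWithin hlim).comp (tendsto_add_atTop_nat M)⟩

theorem lrVisited_iff {y : ℝ} {i : ℕ} : P.lrVisited y i ↔
    1 ≤ i ∧ i < P.N ∧ P.Visits y (𝓝[<] P.c i) ∧ P.Visits y (𝓝[>] P.c i) := by
  constructor
  · rintro ⟨h1, hN, l, r, hl, hr, hlp, hrp, hlt, hrt⟩
    exact ⟨h1, hN,
      visits_of_strictMono hl (tendsto_nhdsWithin_iff.2
        ⟨hlt, Eventually.of_forall fun j => piece_subset_Iio hN (hlp j)⟩),
      visits_of_strictMono hr (tendsto_nhdsWithin_iff.2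
        ⟨hrt, Eventually.of_forall fun j => piece_succ_subset_Ioi h1 hN (hrp j)⟩)⟩
  · rintro ⟨h1, hN, hl, hr⟩
    have hpl : P.piece i ∈ 𝓝[<] P.c i :=
      mem_of_superset (Ioo_mem_nhdsLT (c_lt (by omega) (by omega))) (Ioo_subset_piece i)
    have hpr : P.piece (i + 1) ∈ 𝓝[>] P.c i :=
      mem_of_superset (Ioo_mem_nhdsGT (c_lt (by omega) (by omega))) (Ioo_subset_piece (i + 1))
    obtain ⟨l, hl1, hl2, hl3⟩ := exists_seq_piece hpl hl
    obtain ⟨r, hr1, hr2, hr3⟩ := exists_seq_piece hpr hr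
    exact ⟨h1, hN, l, r, hl1, hr1, hl2, hr2, hl3, hr3⟩

theorem lrVisited_trans {x y : ℝ} (hx : x ∈ P.Xt) (hy : y ∈ P.Xt) (hxy : P.Visits x (𝓝 y))
    {i : ℕ} (h : P.lrVisited y i) : P.lrVisited x i := by
  rw [lrVisited_iff] at h ⊢
  exact ⟨h.1, h.2.1, h.2.2.1.trans isOpen_Iio (hxy.iterate hx hy),
    h.2.2.2.trans isOpen_Ioi (hxy.iterate hx hy)⟩

theorem visits_dplus {x : ℝ} {i : ℕ} (h : P.lrVisited x i) : P.Visits x (𝓝 (P.dplus i)) := by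
  rw [lrVisited_iff] at h
  exact h.2.2.2.map (tendsto_f_right h.2.1)

theorem visits_dminus {x : ℝ} {i : ℕ} (h : P.lrVisited x i) : P.Visits x (𝓝 (P.dminus i)) := by
  rw [lrVisited_iff] at h
  exact h.2.2.1.map (tendsto_f_left h.1 h.2.1)

/-- Near a boundary that is not left-right visited, the orbit eventually avoids one side,
uniformly over the boundaries. -/
theorem exists_one_sided (y : ℝ) : ∃ δ > 0, ∀ k, 1 ≤ k → k < P.N → ¬ P.lrVisited y k →
    (∀ᶠ n in atTop, P.f^[n] y ∉ Ioo (P.c k - δ) (P.c k)) ∨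
    (∀ᶠ n in atTop, P.f^[n] y ∉ Ioo (P.c k) (P.c k + δ)) := by
  have key : ∀ k ∈ Finset.Ico 1 P.N, ∀ᶠ δ in 𝓝[>] (0 : ℝ), ¬ P.lrVisited y k →
      (∀ᶠ n in atTop, P.f^[n] y ∉ Ioo (P.c k - δ) (P.c k)) ∨
      (∀ᶠ n in atTop, P.f^[n] y ∉ Ioo (P.c k) (P.c k + δ)) := by
    intro k hk
    rw [Finset.mem_Ico] at hk
    by_cases hlr : P.lrVisited y k
    · exact Eventually.of_forall fun _ h => absurd hlr h
    have hor : ¬ P.Visits y (𝓝[<] P.c k) ∨ ¬ P.Visits y (𝓝[>] P.c k) := by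
      rw [lrVisited_iff] at hlr
      tauto
    rcases hor with h | h
    · simp only [Visits, not_forall, not_frequently] at h
      obtain ⟨s, hs, h⟩ := h
      obtain ⟨a, ha, has⟩ := mem_nhdsLT_iff_exists_Ioo_subset.1 hs
      filter_upwards [Ioo_mem_nhdsGT (sub_pos.2 ha)] with δ hδ _
      left
      filter_upwards [h] with n hn hmem
      exact hn (has ⟨by linarith [hδ.2, hmem.1], hmem.2⟩)
    · simp only [Visits, not_forall, not_frequently] at h
      obtain ⟨s, hs, h⟩ := h
      obtain ⟨a, ha, has⟩ := mem_nhdsGT_iff_exists_Ioo_subset.1 hs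
      filter_upwards [Ioo_mem_nhdsGT (sub_pos.2 ha)] with δ hδ _
      right
      filter_upwards [h] with n hn hmem
      exact hn (has ⟨hmem.1, by linarith [hδ.2, hmem.2]⟩)
  obtain ⟨δ, hδ, hpos⟩ :=
    (((Finset.eventually_all _).2 key).and self_mem_nhdsWithin).exists
  exact ⟨δ, hpos, fun k h1 hN => hδ k (Finset.mem_Ico.2 ⟨h1, hN⟩)⟩

/-! ### Orbits with no left-right visited boundary -/

/-- An orbit with no left-right visited boundary is asymptotically periodic. -/
theorem exists_asymptotic_period {y : ℝ} (hy : y ∈ P.Xt) (h : ∀ k, ¬ P.lrVisited y k) :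
    ∃ p, 1 ≤ p ∧ Tendsto (fun n => P.f^[n + p] y - P.f^[n] y) atTop (𝓝 0) := by
  obtain ⟨δ, hδ, hside⟩ := exists_one_sided (P := P) y
  have hsep : ∀ᶠ n₀ in atTop, ∀ k ∈ Finset.Ico 1 P.N,
      (∀ n ≥ n₀, P.f^[n] y ∉ Ioo (P.c k - δ) (P.c k)) ∨
      (∀ n ≥ n₀, P.f^[n] y ∉ Ioo (P.c k) (P.c k + δ)) := by
    refine (Finset.eventually_all _).2 fun k hk => ?_
    rw [Finset.mem_Ico] at hk
    rcases hside k hk.1 hk.2 (h k) with h' | h'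
    · filter_upwards [eventually_forall_ge_atTop.2 h'] with n hn using Or.inl hn
    · filter_upwards [eventually_forall_ge_atTop.2 h'] with n hn using Or.inr hn
  obtain ⟨n₀, hn₀⟩ := hsep.exists
  have hstep : ∀ n ≥ n₀, ∀ m ≥ n₀, |P.f^[n] y - P.f^[m] y| < δ →
      |P.f^[n + 1] y - P.f^[m + 1] y| ≤ P.lam * |P.f^[n] y - P.f^[m] y| := by
    intro n hn m hm hnm
    rw [Function.iterate_succ_apply', Function.iterate_succ_apply']
    refine abs_f_sub_le (hy n) (hy m) ?_
    rintro z ⟨k, hk1, hkN, rfl⟩ hz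
    rw [abs_lt] at hnm
    have hne : ∀ n, P.f^[n] y ≠ P.c k := fun n hn => (hy n).2 ⟨k, hk1, hkN, hn⟩
    rw [mem_uIcc] at hz
    rcases hz with hz | hz
    · have h1 := lt_of_le_of_ne hz.1 (hne n)
      have h2 := lt_of_le_of_ne hz.2 (hne m).symm
      rcases hn₀ k (Finset.mem_Ico.2 ⟨hk1, hkN⟩) with h' | h'
      · exact h' n hn ⟨by linarith, h1⟩
      · exact h' m hm ⟨h2, by linarith⟩
    · have h1 := lt_of_le_of_ne hz.1 (hne m)
      have h2 := lt_of_le_of_ne hz.2 (hne n).symm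
      rcases hn₀ k (Finset.mem_Ico.2 ⟨hk1, hkN⟩) with h' | h'
      · exact h' m hm ⟨by linarith, h1⟩
      · exact h' n hn ⟨h2, by linarith⟩
  obtain ⟨a, -, φ, hφ, hlim⟩ := (isCompact_Icc (a := P.c 0) (b := P.c P.N)).tendsto_subseq
    (x := fun n => P.f^[n] y) fun n => (hy n).1
  obtain ⟨M, hM⟩ := Metric.cauchySeq_iff.1 hlim.cauchySeq δ hδ
  set i := max M n₀ with hi
  have hφi : φ i < φ (i + 1) := hφ (by omega)
  have hφn : n₀ ≤ φ i := (le_max_right M n₀).trans (hφ.le_apply)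
  have hclose : |P.f^[φ (i + 1)] y - P.f^[φ i] y| < δ := hM (i + 1) (by omega) i (by omega)
  have hpow : ∀ j, |P.f^[φ (i + 1) + j] y - P.f^[φ i + j] y| ≤ P.lam ^ j * δ := by
    intro j
    have h0 := P.hlam.1
    have h1 := P.hlam.2
    induction j with
    | zero => simpa using hclose.le
    | succ j ih =>
      have hlt : |P.f^[φ (i + 1) + j] y - P.f^[φ i + j] y| < δ := by
        cases j with
        | zero => exact hclose
        | succ j =>
          refine ih.trans_lt ?_
          exact mul_lt_of_lt_one_left hδ (pow_lt_one₀ h0.le h1 (Nat.succ_ne_zero j))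
      refine (hstep _ (by omega) _ (by omega) hlt).trans ?_
      rw [pow_succ', mul_assoc]
      exact mul_le_mul_of_nonneg_left ih h0.le
  refine ⟨φ (i + 1) - φ i, by omega, ?_⟩
  rw [← tendsto_add_atTop_iff_nat (φ i)]
  refine squeeze_zero_norm (a := fun j => P.lam ^ j * δ) (fun j => ?_) ?_
  · rw [Real.norm_eq_abs, show j + φ i + (φ (i + 1) - φ i) = φ (i + 1) + j by omega,
      add_comm j (φ i)]
    exact hpow j
  · simpa using (tendsto_pow_atTop_nhds_zero_of_lt_one P.hlam.1.le P.hlam.2).mul_const δ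

theorem not_visits_of_period {y c d : ℝ} {A : Set ℝ} {p : ℕ} (hy : y ∈ P.Xt) (hd : d ∈ P.Xt)
    (hc : c ∈ P.Δ) (hf : Tendsto P.f (𝓝[A] c) (𝓝 d)) (hp : 1 ≤ p)
    (hper : Tendsto (fun n => P.f^[n + p] y - P.f^[n] y) atTop (𝓝 0)) :
    ¬ P.Visits y (𝓝[A] c) := by
  intro hv
  obtain ⟨θ, hθ, hlim⟩ := hv.exists_strictMono
  have hiter : ∀ s, Tendsto (fun j => P.f^[θ j + (s + 1)] y) atTop (𝓝 (P.f^[s] d)) := by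
    intro s
    induction s with
    | zero =>
      refine (hf.comp hlim).congr fun j => ?_
      exact (Function.iterate_succ_apply' _ _ _).symm
    | succ s ih =>
      rw [Function.iterate_succ_apply']
      have hw : Tendsto (fun j => P.f^[θ j + (s + 1)] y) atTop (𝓝[P.X] (P.f^[s] d)) :=
        tendsto_nhdsWithin_iff.2 ⟨ih, Eventually.of_forall fun j => (hy _).1⟩
      refine ((tendsto_f_within (hd s)).comp hw).congr fun j => ?_
      exact (Function.iterate_succ_apply' _ _ _).symm
  obtain ⟨s, rfl⟩ : ∃ s, p = s + 1 := ⟨p - 1, by omega⟩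
  have hc' : Tendsto (fun j => P.f^[θ j + (s + 1)] y) atTop (𝓝 c) := by
    have := (hper.comp hθ.tendsto_atTop).add (tendsto_nhds_of_tendsto_nhdsWithin hlim)
    simpa using this
  exact (hd s).2 (tendsto_nhds_unique (hiter s) hc' ▸ hc)

/-- If the orbit of `x` accumulates at `y` and at a boundary, then some boundary is left-right
visited by `y`. -/
theorem exists_lrVisited (hD : P.D ⊆ P.Xt) {x y c : ℝ} (hx : x ∈ P.Xt) (hy : y ∈ P.Xt)
    (hxy : P.Visits x (𝓝 y)) (hc : c ∈ P.Δ) (hxc : P.Visits x (𝓝 c)) :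
    ∃ k, P.lrVisited y k := by
  by_contra! hno
  obtain ⟨p, hp, hper⟩ := exists_asymptotic_period hy hno
  have hfar : ∀ z ∈ P.Δ, ∀ᶠ δ in 𝓝[>] (0 : ℝ), ∀ᶠ n in atTop, δ ≤ |P.f^[n] y - z| := by
    rintro _ ⟨k, hk1, hkN, rfl⟩
    have hl := not_visits_of_period hy (dminus_mem hD hk1 hkN) ⟨k, hk1, hkN, rfl⟩
      (tendsto_f_left hk1 hkN) hp hper
    have hr := not_visits_of_period hy (dplus_mem hD hk1 hkN) ⟨k, hk1, hkN, rfl⟩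
      (tendsto_f_right hkN) hp hper
    simp only [Visits, not_forall, not_frequently] at hl hr
    obtain ⟨s, hs, hl⟩ := hl
    obtain ⟨t, ht, hr⟩ := hr
    obtain ⟨a, ha, has⟩ := mem_nhdsLT_iff_exists_Ioo_subset.1 hs
    obtain ⟨b, hb, hbt⟩ := mem_nhdsGT_iff_exists_Ioo_subset.1 ht
    filter_upwards [Ioo_mem_nhdsGT (sub_pos.2 ha), Ioo_mem_nhdsGT (sub_pos.2 hb)] with δ hδa hδb
    filter_upwards [hl, hr] with n hnl hnr
    by_contra hlt
    rw [not_le, abs_lt] at hlt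
    rcases lt_trichotomy (P.f^[n] y) (P.c k) with h | h | h
    · exact hnl (has ⟨by linarith [hδa.2], h⟩)
    · exact (hy n).2 ⟨k, hk1, hkN, h⟩
    · exact hnr (hbt ⟨h, by linarith [hδb.2]⟩)
  obtain ⟨δ, hδ, hpos⟩ :=
    (((Set.Finite.eventually_all finite_Δ).2 hfar).and self_mem_nhdsWithin).exists
  obtain ⟨n₁, hn₁⟩ := eventually_atTop.1 ((Set.Finite.eventually_all finite_Δ).2 hδ)
  have hpos : 0 < δ := hpos
  obtain ⟨m, hm⟩ := (hxy.iterate hx hy n₁ (Metric.ball (P.f^[n₁] y) (δ / 2))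
    (Metric.ball_mem_nhds _ (half_pos hpos))).exists
  have hfollow : ∀ n, |P.f^[m + n] x - P.f^[n₁ + n] y| < δ / 2 := by
    intro n
    induction n with
    | zero => exact hm
    | succ n ih =>
      have hle := abs_f_sub_le (hx (m + n)) (hy (n₁ + n)) fun z hz hzu => by
        have h1 := hn₁ (n₁ + n) (by omega) z hz
        have h2 := abs_sub_right_of_mem_uIcc hzu
        rw [abs_sub_comm (P.f^[m + n] x)] at ih
        linarith
      rw [← Function.iterate_succ_apply' P.f, ← Function.iterate_succ_apply' P.f] at hle
      have h1 := P.hlam.2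
      change |P.f^[m + n + 1] x - P.f^[n₁ + n + 1] y| < δ / 2
      refine hle.trans_lt ?_
      nlinarith [abs_nonneg (P.f^[m + n] x - P.f^[n₁ + n] y)]
  obtain ⟨b, hb, hbc⟩ := frequently_atTop.1
    (hxc (Metric.ball c (δ / 2)) (Metric.ball_mem_nhds _ (half_pos hpos))) m
  obtain ⟨n, rfl⟩ := Nat.exists_eq_add_of_le hb
  have h1 := hn₁ (n₁ + n) (by omega) c hc
  have h2 : |P.f^[m + n] x - c| < δ / 2 := hbc
  have h3 := hfollow n
  have h4 := abs_sub_le (P.f^[n₁ + n] y) (P.f^[m + n] x) c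
  rw [abs_sub_comm] at h3
  linarith

/-! ### Trapping of the orbit between points of an ω-limit set -/

theorem fe_mem_uIcc (hinj : P.InjPieces) {i : ℕ} (h1 : 1 ≤ i) (hN : i ≤ P.N) {a b w : ℝ}
    (ha : a ∈ Icc (P.c (i - 1)) (P.c i)) (hb : b ∈ Icc (P.c (i - 1)) (P.c i))
    (haw : a ≤ w) (hwb : w ≤ b) : P.fe i w ∈ uIcc (P.fe i a) (P.fe i b) := by
  rcases haw.eq_or_lt with rfl | haw
  · exact left_mem_uIcc
  rcases hwb.eq_or_lt with rfl | hwb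
  · exact right_mem_uIcc
  have hcont := continuousOn_fe (P := P) h1 hN
  have hmono := (hcont.mono Ioo_subset_Icc_self).strictMonoOn_of_injOn_Ioo
    (c_lt (by omega) hN) fun u hu v hv huv => hinj i h1 hN (Ioo_subset_piece i hu)
      (Ioo_subset_piece i hv) (by rwa [P.hfe_eq i h1 hN u hu, P.hfe_eq i h1 hN v hv] at huv)
  have hw : w ∈ Ioo (P.c (i - 1)) (P.c i) := ⟨ha.1.trans_lt haw, hwb.trans_le hb.2⟩
  have hca : Tendsto (P.fe i) (𝓝[>] a) (𝓝 (P.fe i a)) := by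
    refine (hcont a ha).mono_left (le_inf inf_le_left (le_principal_iff.2 ?_))
    filter_upwards [Ioo_mem_nhdsGT haw] with z hz
    exact ⟨ha.1.trans hz.1.le, hz.2.le.trans hw.2.le⟩
  have hcb : Tendsto (P.fe i) (𝓝[<] b) (𝓝 (P.fe i b)) := by
    refine (hcont b hb).mono_left (le_inf inf_le_left (le_principal_iff.2 ?_))
    filter_upwards [Ioo_mem_nhdsLT hwb] with z hz
    exact ⟨hw.1.le.trans hz.1.le, hz.2.le.trans hb.2⟩
  have hea : ∀ᶠ z in 𝓝[>] a, z ∈ Ioo (P.c (i - 1)) (P.c i) ∧ z < w := by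
    filter_upwards [Ioo_mem_nhdsGT haw] with z hz
    exact ⟨⟨ha.1.trans_lt hz.1, hz.2.trans hw.2⟩, hz.2⟩
  have heb : ∀ᶠ z in 𝓝[<] b, z ∈ Ioo (P.c (i - 1)) (P.c i) ∧ w < z := by
    filter_upwards [Ioo_mem_nhdsLT hwb] with z hz
    exact ⟨⟨hw.1.trans hz.1, hz.2.trans_le hb.2⟩, hz.1⟩
  rw [mem_uIcc]
  rcases hmono with hm | hm
  · exact Or.inl ⟨le_of_tendsto hca (hea.mono fun z hz => (hm hz.1 hw hz.2).le),
      ge_of_tendsto hcb (heb.mono fun z hz => (hm hw hz.1 hz.2).le)⟩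
  · exact Or.inr ⟨le_of_tendsto hcb (heb.mono fun z hz => (hm hw hz.1 hz.2).le),
      ge_of_tendsto hca (hea.mono fun z hz => (hm hz.1 hw hz.2).le)⟩

/-- If `u < v` are close, lie in the ω-limit set of `d`, and a boundary separates them, then this
boundary is left-right visited by `d`. -/
theorem exists_straddle (d : ℝ) : ∃ ε > 0, ∀ k, 1 ≤ k → k < P.N → ∀ u v, P.Visits d (𝓝 u) →
    P.Visits d (𝓝 v) → u < P.c k → P.c k < v → v - u < ε → P.lrVisited d k := by
  obtain ⟨ε, hε, hside⟩ := exists_one_sided (P := P) d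
  refine ⟨ε, hε, fun k h1 hN u v hu hv huc hcv hlt => ?_⟩
  by_contra hno
  rcases hside k h1 hN hno with h | h
  · exact hu _ (Ioo_mem_nhds (by linarith) huc) h
  · exact hv _ (Ioo_mem_nhds hcv (by linarith)) h

/-- The points of the ω-limit set of `d` whose orbit avoids `Δ`. -/
def regularLimits (P : PCIM) (d : ℝ) : Set ℝ := {z | z ∈ P.Xt ∧ P.Visits d (𝓝 z)}

theorem f_mem_regularLimits {d z : ℝ} (hd : d ∈ P.Xt) (hz : z ∈ P.regularLimits d) :
    P.f z ∈ P.regularLimits d :=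
  ⟨Xt_iterate hz.1 1, hz.2.iterate hd hz.1 1⟩

theorem trapping_step (hinj : P.InjPieces) (hD : P.D ⊆ P.Xt) {d ε : ℝ} (hd : d ∈ P.Xt)
    (hε : ∀ k, 1 ≤ k → k < P.N → ∀ u v, P.Visits d (𝓝 u) →
      P.Visits d (𝓝 v) → u < P.c k → P.c k < v → v - u < ε → P.lrVisited d k)
    {u v w : ℝ} (hu : u ∈ P.regularLimits d) (hv : v ∈ P.regularLimits d) (hw : w ∈ P.Xt)
    (hmem : w ∈ uIcc u v) (huv : |u - v| < ε) :
    ∃ u' ∈ P.regularLimits d, ∃ v' ∈ P.regularLimits d,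
      P.f w ∈ uIcc u' v' ∧ |u' - v'| ≤ |u - v| := by
  wlog hle : u ≤ v generalizing u v
  · obtain ⟨u', hu', v', hv', h⟩ := this hv hu (by rwa [uIcc_comm]) (by rwa [abs_sub_comm])
      (not_le.1 hle).le
    exact ⟨u', hu', v', hv', by rwa [abs_sub_comm u v]⟩
  rw [uIcc_of_le hle] at hmem
  have habs : |u - v| = v - u := by rw [abs_sub_comm, abs_of_nonneg (by linarith)]
  rw [habs] at huv ⊢
  have hu0 := hu.1 0
  have hv0 := hv.1 0
  have hw0 := hw 0
  simp only [Function.iterate_zero, id] at hu0 hv0 hw0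
  obtain ⟨i, h1, hN, hi⟩ := exists_mem_Icc hw0.1
  have hlt : P.c (i - 1) < P.c i := c_lt (by omega) hN
  obtain ⟨a, ha, hua, haw, haS⟩ : ∃ a ∈ Icc (P.c (i - 1)) (P.c i), u ≤ a ∧ a ≤ w ∧
      P.fe i a ∈ P.regularLimits d := by
    by_cases h : P.c (i - 1) ≤ u
    · have hui : u ∈ Icc (P.c (i - 1)) (P.c i) := ⟨h, hmem.1.trans hi.2⟩
      refine ⟨u, hui, le_rfl, hmem.1, ?_⟩
      rw [fe_eq_f h1 hN hui hu0.2]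
      exact f_mem_regularLimits hd hu
    · rw [not_le] at h
      have hi1 : i ≠ 1 := by
        rintro rfl
        exact h.not_ge hu0.1.1
      have hcv : P.c (i - 1) < v := lt_of_le_of_ne (hi.1.trans hmem.2)
        fun hcv => hv0.2 ⟨i - 1, by omega, by omega, hcv.symm⟩
      have hk := hε (i - 1) (by omega) (by omega) u v hu.2 hv.2 h hcv huv
      refine ⟨P.c (i - 1), ⟨le_rfl, hlt.le⟩, h.le, hi.1, ?_⟩
      have hdp : P.fe i (P.c (i - 1)) = P.dplus (i - 1) := by
        rw [dplus, Nat.sub_add_cancel h1]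
      rw [hdp]
      exact ⟨dplus_mem hD (by omega) (by omega), visits_dplus hk⟩
  obtain ⟨b, hb, hbv, hwb, hbS⟩ : ∃ b ∈ Icc (P.c (i - 1)) (P.c i), b ≤ v ∧ w ≤ b ∧
      P.fe i b ∈ P.regularLimits d := by
    by_cases h : v ≤ P.c i
    · have hvi : v ∈ Icc (P.c (i - 1)) (P.c i) := ⟨hi.1.trans hmem.2, h⟩
      refine ⟨v, hvi, le_rfl, hmem.2, ?_⟩
      rw [fe_eq_f h1 hN hvi hv0.2]
      exact f_mem_regularLimits hd hv
    · rw [not_le] at h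
      have hiN : i ≠ P.N := by
        rintro rfl
        exact h.not_ge hv0.1.2
      have huc : u < P.c i := lt_of_le_of_ne (hmem.1.trans hi.2)
        fun huc => hu0.2 ⟨i, by omega, by omega, huc⟩
      have hk := hε i (by omega) (by omega) u v hu.2 hv.2 huc h huv
      exact ⟨P.c i, ⟨hlt.le, le_rfl⟩, h.le, hi.2,
        dminus_mem hD (by omega) (by omega), visits_dminus hk⟩
  refine ⟨_, haS, _, hbS, ?_, ?_⟩
  · rw [← fe_eq_f h1 hN hi hw0.2]
    exact fe_mem_uIcc hinj h1 hN ha hb haw hwb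
  · have hlip := P.hfe_lip i h1 hN a ha b hb
    rw [abs_sub_comm a b, abs_of_nonneg (by linarith : 0 ≤ b - a)] at hlip
    nlinarith [P.hlam.1, P.hlam.2]

theorem visits_of_visits (hinj : P.InjPieces) (hD : P.D ⊆ P.Xt) {x d : ℝ} (hx : x ∈ P.Xt)
    (hd : d ∈ P.Xt) {i : ℕ} (hxi : P.lrVisited x i) (hdi : P.lrVisited d i)
    (hdd : P.Visits d (𝓝 d)) {z : ℝ} (hz : P.Visits x (𝓝 z)) : P.Visits d (𝓝 z) := by
  obtain ⟨ε, hε, hstr⟩ := exists_straddle (P := P) d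
  have hclosure : z ∈ closure {t | P.Visits d (𝓝 t)} := by
    rw [Metric.mem_closure_iff]
    intro η hη
    have hρ : 0 < min (ε / 2) (η / 4) := by positivity
    set ρ := min (ε / 2) (η / 4) with hρdef
    have hρε : ρ ≤ ε / 2 := min_le_left _ _
    have hρη : ρ ≤ η / 4 := min_le_right _ _
    rw [lrVisited_iff] at hxi hdi
    obtain ⟨a, ha⟩ := (hdi.2.2.1 _ (Ioo_mem_nhdsLT (sub_lt_self (P.c i) hρ))).exists
    obtain ⟨b, hb⟩ := (hdi.2.2.2 _ (Ioo_mem_nhdsGT (lt_add_of_pos_right (P.c i) hρ))).exists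
    obtain ⟨n₀, hn₀⟩ := (hxi.2.2.2 _ (Ioo_mem_nhdsGT hb.1)).exists
    have hS : ∀ n, P.f^[n] d ∈ P.regularLimits d := fun n =>
      ⟨Xt_iterate hd n, hdd.iterate hd hd n⟩
    have htrap : ∀ n, ∃ u ∈ P.regularLimits d, ∃ v ∈ P.regularLimits d,
        P.f^[n₀ + n] x ∈ uIcc u v ∧ |u - v| < 2 * ρ := by
      intro n
      induction n with
      | zero =>
        refine ⟨_, hS a, _, hS b, ?_, ?_⟩
        · rw [mem_uIcc]
          exact Or.inl ⟨(ha.2.trans hn₀.1).le, hn₀.2.le⟩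
        · rw [abs_lt]
          constructor <;> linarith [ha.1, ha.2, hb.1, hb.2]
      | succ n ih =>
        obtain ⟨u, hu, v, hv, hmem, hlt⟩ := ih
        obtain ⟨u', hu', v', hv', hmem', hle⟩ := trapping_step hinj hD hd hstr hu hv
          (Xt_iterate hx (n₀ + n)) hmem (by linarith)
        refine ⟨u', hu', v', hv', ?_, hle.trans_lt hlt⟩
        rwa [← Function.iterate_succ_apply' P.f] at hmem'
    obtain ⟨m, hm, hmz⟩ := frequently_atTop.1
      (hz (Metric.ball z (η / 2)) (Metric.ball_mem_nhds _ (half_pos hη))) n₀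
    obtain ⟨n, rfl⟩ := Nat.exists_eq_add_of_le hm
    obtain ⟨u, hu, v, -, hmem, hlt⟩ := htrap n
    refine ⟨u, hu.2, ?_⟩
    have h1 : |P.f^[n₀ + n] x - z| < η / 2 := hmz
    have h2 := abs_sub_left_of_mem_uIcc hmem
    rw [abs_sub_comm v u] at h2
    have h3 := abs_sub_le z (P.f^[n₀ + n] x) u
    rw [abs_sub_comm z (P.f^[n₀ + n] x)] at h3
    rw [Real.dist_eq]
    linarith
  intro s hs
  obtain ⟨o, hos, ho, hzo⟩ := mem_nhds_iff.1 hs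
  obtain ⟨t, hto, ht⟩ := mem_closure_iff.1 hclosure o ho hzo
  exact (ht o (ho.mem_nhds hto)).mono fun n hn => hos hn

/-! ### Minimal classes -/

/-- Some boundary left-right visited by `x` is minimal for the transitive relation
`c_k ∈ Δ_lr(d_j^+)` and related to itself. -/
theorem exists_minimal (hD : P.D ⊆ P.Xt) {x : ℝ} (hx : x ∈ P.Xt) (hlr : ∃ k, P.lrVisited x k) :
    ∃ i, P.lrVisited x i ∧ P.lrVisited (P.dplus i) i ∧
      ∀ k, P.lrVisited (P.dplus i) k → P.lrVisited (P.dplus k) i := by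
  have hfin : ∀ y, {k | P.lrVisited y k}.Finite := fun y =>
    (Set.finite_Iio P.N).subset fun k hk => hk.2.1
  have hmem : ∀ {y k}, P.lrVisited y k → P.dplus k ∈ P.Xt := fun h => dplus_mem hD h.1 h.2.1
  have htrans : ∀ {y k}, y ∈ P.Xt → P.lrVisited y k →
      {l | P.lrVisited (P.dplus k) l} ⊆ {l | P.lrVisited y l} := fun hy h l hl =>
    lrVisited_trans hy (hmem h) (visits_dplus h) hl
  obtain ⟨i, hi, hmin⟩ := Set.exists_min_image {k | P.lrVisited x k}
    (fun k => {l | P.lrVisited (P.dplus k) l}.ncard) (hfin x) hlr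
  have heq : ∀ {k}, P.lrVisited (P.dplus i) k →
      {l | P.lrVisited (P.dplus k) l} = {l | P.lrVisited (P.dplus i) l} := fun {k} hk =>
    Set.eq_of_subset_of_ncard_le (htrans (hmem hi) hk) (hmin k (htrans hx hi hk)) (hfin _)
  have hxc : P.Visits x (𝓝 (P.c i)) := (lrVisited_iff.1 hi).2.2.1.mono nhdsWithin_le_nhds
  obtain ⟨j, hj⟩ := exists_lrVisited hD hx (hmem hi) (visits_dplus hi)
    ⟨i, hi.1, hi.2.1, rfl⟩ hxc
  have hj' : j ∈ {l | P.lrVisited (P.dplus i) l} := hj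
  refine ⟨j, htrans hx hi hj, ?_, fun k hk => ?_⟩
  · rwa [← heq hj] at hj'
  · have hk' : k ∈ {l | P.lrVisited (P.dplus j) l} := hk
    rw [heq hj] at hk'
    rwa [← heq hk'] at hj'

theorem minimalClass_of_forall {x : ℝ} (hx : x ∈ P.Xt) {i : ℕ} (hi : P.lrVisited x i)
    (h : ∀ k, P.lrVisited (P.dplus i) k → P.lrVisited (P.dplus k) i) : P.MinimalClass i := by
  have hi' : P.inΔlr i := ⟨x, hx, hi⟩
  refine ⟨hi', ?_⟩
  rintro j hj (hs | ⟨a, b, ha, hb, hja, hib, hab⟩)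
  · exact hs
  have hle : ∀ {k}, P.inΔlr k → k ∈ Iic P.N := fun ⟨_, _, hk⟩ => hk.2.1.le
  obtain rfl := P.hc.injOn (hle hj) (hle ha) hja
  obtain rfl := P.hc.injOn (hle hi') (hle hb) hib
  exact Or.inr ⟨j, i, hj, hi', rfl, rfl, hab, h j hab⟩

end PCIM

/-- If `f` is injective on each piece, `D ⊆ X̃`, `x ∈ X̃` and `Δ_lr(x) ≠ ∅`, then
there is `i` with `c_i ∈ Δ_lr(x)`, `[c_i]` a minimal class, and
`ω(x) = ω(d_i^+) = closure (O(d_i^+))`. -/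
theorem stmt18 (P : PCIM) (hinj : P.InjPieces) (hD : P.D ⊆ P.Xt)
    (x : ℝ) (hx : x ∈ P.Xt) (hlr : ∃ k, P.lrVisited x k) :
    ∃ i, P.lrVisited x i ∧ P.MinimalClass i ∧
      P.omega x = P.omega (P.dplus i) ∧ P.omega x = closure (P.orbit (P.dplus i)) := by
  obtain ⟨i, hxi, hdi, hmin⟩ := PCIM.exists_minimal hD hx hlr
  have hd : P.dplus i ∈ P.Xt := PCIM.dplus_mem hD hxi.1 hxi.2.1
  have hdd : P.Visits (P.dplus i) (𝓝 (P.dplus i)) := PCIM.visits_dplus hdi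
  have homega : P.omega x = P.omega (P.dplus i) := by
    ext z
    rw [PCIM.mem_omega_iff, PCIM.mem_omega_iff]
    refine ⟨PCIM.visits_of_visits hinj hD hx hd hxi hdi hdd, fun h => ?_⟩
    rw [← nhdsWithin_univ] at h ⊢
    exact h.trans isOpen_univ ((PCIM.visits_dplus hxi).iterate hx hd)
  refine ⟨i, hxi, PCIM.minimalClass_of_forall hx hxi hmin, homega, ?_⟩
  rw [homega]
  ext z
  rw [PCIM.mem_omega_iff, mem_closure_iff_nhds]
  constructor
  · intro h s hs
    obtain ⟨n, hn⟩ := (h s hs).exists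
    exact ⟨_, hn, n, rfl⟩
  · intro h s hs
    obtain ⟨o, hos, ho, hzo⟩ := mem_nhds_iff.1 hs
    obtain ⟨_, hto, n, rfl⟩ := h o (ho.mem_nhds hzo)
    exact (hdd.iterate hd hd n o (ho.mem_nhds hto)).mono fun m hm => hos hm
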